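/- Let Δ and Δ′ be integers such that Δ, Δ′, and ΔΔ′ are all non-squares. For each prime p define w(p) = ((Δ′/p) − (Δ/p))/2 if p is odd and p ∤ Δ, and w(p) = 0 otherwise, where (·/p) is the Legendre symbol. Then there exists a constant C such that for all x ≥ 3, |∑_{p ≤ x} w(p)²/p − (1/2)·log log x| ≤ C, the sum being over primes p ≤ x. -/

import Mathlib

open Finset ArithmeticFunction

/-- Abel's inequality for weighted sums with bounded partial sums and antitone weights. -/
theorem norm_sum_smul_le_of_antitone {E : Type*} [NormedAddCommGroup E] [NormedSpace ℝ E]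
    {a : ℕ → E} {f : ℕ → ℝ} {B : ℝ} {m n : ℕ} (hmn : m ≤ n)
    (hf : ∀ i, m < i → f (i + 1) ≤ f i) (hf0 : ∀ i, m < i → 0 ≤ f i)
    (ha : ∀ k, ‖∑ i ∈ Ioc m k, a i‖ ≤ B) :
    ‖∑ i ∈ Ioc m n, f i • a i‖ ≤ B * f (m + 1) := by
  have tel : ∑ i ∈ Ioc m n, (f i - f (i + 1)) = f (m + 1) - f (n + 1) := by
    induction n, hmn using Nat.le_induction with
    | base => simp
    | succ n hn ih => rw [sum_Ioc_succ_top hn, ih]; ring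
  have key : ∑ i ∈ Ioc m n, f i • a i = f (n + 1) • ∑ i ∈ Ioc m n, a i +
      ∑ i ∈ Ioc m n, (f i - f (i + 1)) • ∑ j ∈ Ioc m i, a j := by
    clear tel
    induction n, hmn using Nat.le_induction with
    | base => simp
    | succ n hn ih =>
      simp only [sum_Ioc_succ_top hn, ih, smul_add, sub_smul]
      abel
  rw [key]
  refine (norm_add_le _ _).trans ?_
  have h1 : ‖f (n + 1) • ∑ i ∈ Ioc m n, a i‖ ≤ f (n + 1) * B := by
    rw [norm_smul, Real.norm_of_nonneg (hf0 _ (by omega))]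
    exact mul_le_mul_of_nonneg_left (ha n) (hf0 _ (by omega))
  have h2 : ‖∑ i ∈ Ioc m n, (f i - f (i + 1)) • ∑ j ∈ Ioc m i, a j‖ ≤
      ∑ i ∈ Ioc m n, (f i - f (i + 1)) * B := by
    refine norm_sum_le_of_le _ fun i hi ↦ ?_
    have hi' := sub_nonneg.2 (hf i (mem_Ioc.1 hi).1)
    rw [norm_smul, Real.norm_of_nonneg hi']
    exact mul_le_mul_of_nonneg_left (ha i) hi'
  rw [← sum_mul, tel] at h2
  linarith

section Character

variable {q : ℕ} [NeZero q] {χ : DirichletCharacter ℂ q}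

theorem DirichletCharacter.norm_sum_range_le (hχ : χ ≠ 1) (n : ℕ) :
    ‖∑ i ∈ range n, χ i‖ ≤ q := by
  have hq : 0 < q := Nat.pos_of_ne_zero (NeZero.ne q)
  have block (k : ℕ) : ∑ i ∈ range q, χ ((k + i : ℕ) : ZMod q) = 0 := by
    have h := MulChar.sum_eq_zero_of_ne_one hχ
    rw [← Equiv.sum_comp (Equiv.addLeft (k : ZMod q))] at h
    rw [← h]
    exact sum_bij' (s := range q) (t := univ) (fun i _ ↦ (i : ZMod q)) (fun a _ ↦ a.val) (by simp)
      (by simp [ZMod.val_lt]) (fun i hi ↦ ZMod.val_cast_of_lt (mem_range.1 hi)) (by simp) (by simp)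
  induction n using Nat.strong_induction_on with
  | _ n ih =>
    rcases lt_or_ge n q with h | h
    · refine (norm_sum_le_of_le _ fun i _ ↦ χ.norm_le_one _).trans ?_
      simpa using h.le
    · obtain ⟨k, rfl⟩ := Nat.exists_eq_add_of_le' h
      rw [sum_range_add, block, add_zero]
      exact ih k (by omega)

theorem DirichletCharacter.norm_sum_Ioc_le (hχ : χ ≠ 1) (m n : ℕ) :
    ‖∑ i ∈ Ioc m n, χ i‖ ≤ 2 * q := by
  rcases le_total n m with h | h
  · simp [Ioc_eq_empty_of_le h]
  · rw [show Ioc m n = Ico (m + 1) (n + 1) by ext; simp only [mem_Ioc, mem_Ico]; omega,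
      sum_Ico_eq_sub _ (by omega : m + 1 ≤ n + 1)]
    refine (norm_sub_le _ _).trans ?_
    linarith [norm_sum_range_le hχ (n + 1), norm_sum_range_le hχ (m + 1)]

/-- Partial sums of `L(1, χ)` approximate it with error `O(1 / N)`. -/
theorem DirichletCharacter.norm_LFunction_one_sub_sum_le (hχ : χ ≠ 1) (N : ℕ) :
    ‖χ.LFunction 1 - ∑ n ∈ Ioc 0 N, χ n / n‖ ≤ 2 * q / (N + 1) := by
  have term_eq (s : ℝ) (n : ℕ) (hn : n ≠ 0) :
      LSeries.term (χ ·) s n = ((n : ℝ) ^ (-s)) • χ n := by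
    rw [LSeries.term_of_ne_zero hn, Complex.real_smul, Real.rpow_neg (by positivity),
      Complex.ofReal_inv, Complex.ofReal_cpow (by positivity)]
    simp [div_eq_mul_inv, mul_comm]
  have bound (s : ℝ) (hs : 1 < s) :
      ‖χ.LFunction s - ∑ n ∈ Ioc 0 N, LSeries.term (χ ·) s n‖ ≤ 2 * q / (N + 1) := by
    rw [LFunction_eq_LSeries χ (by simpa using hs)]
    have hsum := (LSeriesSummable_of_one_lt_re χ (s := s) (by simpa using hs)).hasSum
    have hlim : Filter.Tendsto (fun M ↦ ∑ n ∈ Ioc 0 M, LSeries.term (χ ·) s n) Filter.atTop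
        (nhds (LSeries (χ ·) s)) := by
      have := (Filter.tendsto_add_atTop_iff_nat 1).2 hsum.tendsto_sum_nat
      refine this.congr fun M ↦ ?_
      rw [sum_range_succ', LSeries.term_zero, add_zero, range_eq_Ico, sum_Ico_add' _ 0 M 1]
      exact sum_congr (by ext; simp only [mem_Ioc, mem_Ico]; omega) fun _ _ ↦ rfl
    refine le_of_tendsto (hlim.sub_const _).norm ?_
    filter_upwards [Filter.eventually_ge_atTop N] with M hM
    rw [← sum_Ioc_consecutive _ (Nat.zero_le N) hM, add_sub_cancel_left,
      sum_congr rfl fun n hn ↦ term_eq s n (by have := (mem_Ioc.1 hn).1; omega)]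
    refine (norm_sum_smul_le_of_antitone hM (fun i hi ↦ ?_) (fun i _ ↦ by positivity)
      (norm_sum_Ioc_le hχ N)).trans ?_
    · have : 0 < i := by omega
      exact Real.rpow_le_rpow_of_nonpos (by positivity) (by simp) (by linarith)
    · rw [div_eq_mul_inv]
      refine mul_le_mul_of_nonneg_left ?_ (by positivity)
      rw [← Real.rpow_neg_one]
      push_cast
      exact Real.rpow_le_rpow_of_exponent_le (by linarith [Nat.cast_nonneg (α := ℝ) N])
        (by linarith)
  have hcont : ContinuousAt (fun s : ℝ ↦
      ‖χ.LFunction s - ∑ n ∈ Ioc 0 N, LSeries.term (χ ·) s n‖) 1 := by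
    refine (ContinuousAt.sub ?_ ?_).norm
    · exact ((differentiable_LFunction hχ).continuous.comp
        Complex.continuous_ofReal).continuousAt
    · refine (continuous_finsetSum _ fun n hn ↦ ?_).continuousAt
      have hn : n ≠ 0 := by have := (mem_Ioc.1 hn).1; omega
      simp only [term_eq _ n hn]
      have : (n : ℝ) ≠ 0 := by exact_mod_cast hn
      fun_prop (disch := assumption)
  have := le_of_tendsto (hcont.tendsto.mono_left nhdsWithin_le_nhds)
    (eventually_nhdsWithin_of_forall (s := Set.Ioi 1) bound)
  rw [Complex.ofReal_one] at this
  rwa [sum_congr rfl fun n hn ↦ by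
    rw [LSeries.term_of_ne_zero (by have := (mem_Ioc.1 hn).1; omega), Complex.cpow_one]] at this

end Character

theorem abs_sum_vonMangoldt_div_sub_le :
    ∃ B : ℝ, ∀ N : ℕ, |∑ n ∈ Ioc 0 N, (Λ n / n - 1 / n)| ≤ B := by
  refine ⟨Real.log 4 + 6, fun N ↦ ?_⟩
  rcases Nat.eq_zero_or_pos N with rfl | hN
  · simp; positivity
  have hN' : (0 : ℝ) < N := by exact_mod_cast hN
  have hψ : ∑ n ∈ Ioc 0 N, Λ n ≤ (Real.log 4 + 4) * N := by
    simpa [Chebyshev.psi] using Chebyshev.psi_le_const_mul_self hN'.le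
  have hlog : ∑ n ∈ Ioc 0 N, Real.log n = ∑ n ∈ Ioc 0 N, Λ n * (N / n : ℕ) := by
    rw [← sum_Ioc_mul_zeta_eq_sum, vonMangoldt_mul_zeta]
    rfl
  have hlog_le : ∑ n ∈ Ioc 0 N, Real.log n ≤ N * Real.log N := by
    refine (sum_le_card_nsmul _ _ (Real.log N) fun n hn ↦ ?_).trans (by simp)
    have := mem_Ioc.1 hn
    exact Real.log_le_log (by exact_mod_cast this.1) (by exact_mod_cast this.2)
  have hle_log : N * Real.log N - N ≤ ∑ n ∈ Ioc 0 N, Real.log n := by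
    have h := Real.log_le_log (by positivity)
      (Real.pow_div_factorial_le_exp (N : ℝ) N.cast_nonneg N)
    rw [Real.log_div (by positivity) (by positivity), Real.log_pow, Real.log_exp,
      ← prod_Ico_id_eq_factorial, show Ico 1 (N + 1) = Ioc 0 N by
        ext; simp only [mem_Ioc, mem_Ico]; omega,
      Nat.cast_prod, Real.log_prod fun n hn ↦ by
        have := (mem_Ioc.1 hn).1
        positivity] at h
    linarith
  have hupper : ∑ n ∈ Ioc 0 N, Λ n * (N / n : ℕ) ≤ N * ∑ n ∈ Ioc 0 N, Λ n / n := by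
    rw [mul_sum]
    refine sum_le_sum fun n _ ↦ ?_
    rw [mul_div_left_comm]
    exact mul_le_mul_of_nonneg_left Nat.cast_div_le vonMangoldt_nonneg
  have hlower : N * ∑ n ∈ Ioc 0 N, Λ n / n - ∑ n ∈ Ioc 0 N, Λ n ≤
      ∑ n ∈ Ioc 0 N, Λ n * (N / n : ℕ) := by
    rw [mul_sum, ← sum_sub_distrib]
    refine sum_le_sum fun n _ ↦ ?_
    rw [mul_div_left_comm, ← mul_sub_one]
    refine mul_le_mul_of_nonneg_left ?_ vonMangoldt_nonneg
    rw [← Nat.floor_div_eq_div (K := ℝ)]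
    linarith [Nat.lt_floor_add_one ((N : ℝ) / n)]
  have hharm : ((harmonic N : ℚ) : ℝ) = ∑ n ∈ Ioc 0 N, 1 / (n : ℝ) := by
    rw [harmonic_eq_sum_Icc]
    push_cast
    exact sum_congr (by ext; simp only [mem_Icc, mem_Ioc]; omega) fun _ _ ↦ by simp
  have h1 := harmonic_le_one_add_log N
  have h2 := (Real.log_le_log hN' (by simp)).trans (log_add_one_le_harmonic N)
  rw [hharm] at h1 h2
  rw [sum_sub_distrib]
  set S := ∑ n ∈ Ioc 0 N, Λ n / n
  have h3 : Real.log N - 1 ≤ S := by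
    refine le_of_mul_le_mul_left ?_ hN'
    linarith
  have h4 : S ≤ Real.log N + (Real.log 4 + 4) := by
    refine le_of_mul_le_mul_left ?_ hN'
    linarith
  have : 0 ≤ Real.log 4 := by positivity
  rw [abs_le]
  constructor <;> linarith

theorem DirichletCharacter.norm_sum_mul_vonMangoldt_div_le {q : ℕ} [NeZero q]
    {χ : DirichletCharacter ℂ q} (hχ : χ ≠ 1) :
    ∃ B : ℝ, ∀ N : ℕ, ‖∑ n ∈ Ioc 0 N, χ n * Λ n / n‖ ≤ B := by
  obtain ⟨A, hA⟩ : ∃ A : ℝ, ∀ N : ℕ, ‖∑ n ∈ Ioc 0 N, χ n * Real.log n / n‖ ≤ A := by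
    refine ⟨‖χ 2 * Real.log 2 / 2‖ + 2 * q * (Real.log 3 / 3), fun N ↦ ?_⟩
    have h0 : (0 : ℝ) ≤ 2 * q * (Real.log 3 / 3) := by positivity
    rcases lt_or_ge N 2 with hN | hN
    · interval_cases N <;> simp <;> positivity
    · rw [← sum_Ioc_consecutive _ (Nat.zero_le 2) hN]
      refine (norm_add_le _ _).trans (add_le_add ?_ ?_)
      · simp [sum_Ioc_succ_top]
      · have := norm_sum_smul_le_of_antitone (a := fun n : ℕ ↦ χ n)
          (f := fun n ↦ Real.log n / n) hN (fun i hi ↦ ?_) (fun i _ ↦ by positivity)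
          (norm_sum_Ioc_le hχ 2)
        · refine le_trans (le_of_eq ?_) (this.trans (by norm_num))
          congr 1
          refine sum_congr rfl fun n _ ↦ ?_
          simp
          ring
        · have h3 : (3 : ℝ) ≤ i := by exact_mod_cast hi
          refine Real.log_div_self_antitoneOn ?_ ?_ (by simp)
          · exact (Real.exp_one_lt_three.le.trans h3)
          · push_cast
            exact (Real.exp_one_lt_three.le.trans (by linarith))
  set L := χ.LFunction 1
  have hL0 : L ≠ 0 := LFunction_apply_one_ne_zero hχ
  let f : ArithmeticFunction ℂ := ⟨fun n ↦ χ n * Λ n / n, by simp⟩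
  let g : ArithmeticFunction ℂ := ⟨fun n ↦ χ n / n, by simp⟩
  have hfg (n : ℕ) : (f * g) n = χ n * Real.log n / n := by
    rw [ArithmeticFunction.mul_apply, ← vonMangoldt_sum, Complex.ofReal_sum, mul_sum, sum_div,
      Nat.sum_divisorsAntidiagonal (f := fun a b ↦ f a * g b)]
    refine sum_congr rfl fun d hd ↦ ?_
    obtain ⟨e, rfl⟩ := Nat.dvd_of_mem_divisors hd
    have hd0 : d ≠ 0 := by rintro rfl; simp at hd
    rw [Nat.mul_div_cancel_left _ (Nat.pos_of_ne_zero hd0)]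
    simp only [f, g, ArithmeticFunction.coe_mk, Nat.cast_mul, map_mul]
    ring
  refine ⟨(A + 2 * q * (Real.log 4 + 4)) / ‖L‖, fun N ↦ ?_⟩
  rw [le_div_iff₀ (norm_pos_iff.2 hL0), ← norm_mul]
  have hid : (∑ n ∈ Ioc 0 N, χ n * Λ n / n) * L = ∑ n ∈ Ioc 0 N, χ n * Real.log n / n +
      ∑ n ∈ Ioc 0 N, f n * (L - ∑ m ∈ Ioc 0 (N / n), χ m / m) := by
    rw [← sum_congr rfl fun n _ ↦ hfg n, sum_Ioc_mul_eq_sum_sum, ← sum_add_distrib, sum_mul]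
    refine sum_congr rfl fun n _ ↦ ?_
    simp only [f, g, ArithmeticFunction.coe_mk]
    ring
  rw [hid]
  refine (norm_add_le _ _).trans (add_le_add (hA N) ?_)
  rcases Nat.eq_zero_or_pos N with rfl | hN
  · simp; positivity
  have hN' : (0 : ℝ) < N := by exact_mod_cast hN
  have hψ : ∑ n ∈ Ioc 0 N, Λ n ≤ (Real.log 4 + 4) * N := by
    simpa [Chebyshev.psi] using Chebyshev.psi_le_const_mul_self hN'.le
  calc _ ≤ ∑ n ∈ Ioc 0 N, 2 * q / N * Λ n := norm_sum_le_of_le _ fun n hn ↦ ?_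
    _ ≤ _ := by
      rw [← mul_sum, div_mul_eq_mul_div, div_le_iff₀ hN', mul_assoc (2 * q : ℝ)]
      exact mul_le_mul_of_nonneg_left hψ (by positivity)
  have hn : (0 : ℝ) < n := by exact_mod_cast (mem_Ioc.1 hn).1
  have hf : ‖f n‖ ≤ Λ n / n := by
    simp only [f, ArithmeticFunction.coe_mk, norm_div, norm_mul, Complex.norm_natCast,
      Complex.norm_real, Real.norm_of_nonneg vonMangoldt_nonneg]
    gcongr
    exact mul_le_of_le_one_left vonMangoldt_nonneg (χ.norm_le_one _)
  rw [norm_mul]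
  refine (mul_le_mul hf (norm_LFunction_one_sub_sum_le hχ (N / n)) (norm_nonneg _)
    (div_nonneg vonMangoldt_nonneg hn.le)).trans ?_
  have : (N : ℝ) / n ≤ (N / n : ℕ) + 1 := by
    rw [← Nat.floor_div_eq_div (K := ℝ)]
    exact (Nat.lt_floor_add_one _).le
  calc Λ n / n * (2 * q / ((N / n : ℕ) + 1)) ≤ Λ n / n * (2 * q / (N / n : ℝ)) := by
        have := vonMangoldt_nonneg (n := n)
        gcongr
    _ = _ := by field_simp

theorem abs_sum_inv_mul_log_sub_log_log_le :
    ∃ B : ℝ, ∀ x : ℝ, 3 ≤ x →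
      |∑ n ∈ Ioc 1 ⌊x⌋₊, 1 / (n * Real.log n) - Real.log (Real.log x)| ≤ B := by
  have lower (N : ℕ) (hN : 1 ≤ N) : Real.log (Real.log (N + 1)) - Real.log (Real.log 2) ≤
      ∑ n ∈ Ioc 1 N, 1 / (n * Real.log n) := by
    induction N, hN using Nat.le_induction with
    | base => norm_num
    | succ n hn ih =>
      rw [sum_Ioc_succ_top hn]
      have hn0 : (0 : ℝ) < n := by exact_mod_cast hn
      have hl : 0 < Real.log (n + 1) := Real.log_pos (by linarith)
      have hl' : 0 < Real.log (n + 1 + 1) := Real.log_pos (by linarith)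
      have h1 := Real.log_le_sub_one_of_pos (div_pos hl' hl)
      have h2 := Real.log_le_sub_one_of_pos (x := ((n : ℝ) + 1 + 1) / (n + 1)) (by positivity)
      rw [Real.log_div (by positivity) (by positivity)] at h1 h2
      have h3 : Real.log (n + 1 + 1) / Real.log (n + 1) - 1 ≤ 1 / ((n + 1) * Real.log (n + 1)) := by
        rw [div_sub_one hl.ne', ← div_div]
        gcongr
        refine h2.trans (le_of_eq ?_)
        field_simp
        ring
      push_cast
      linarith
  have upper (N : ℕ) (hN : 2 ≤ N) : ∑ n ∈ Ioc 1 N, 1 / (n * Real.log n) ≤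
      1 / (2 * Real.log 2) - Real.log (Real.log 2) + Real.log (Real.log N) := by
    induction N, hN using Nat.le_induction with
    | base => simp
    | succ n hn ih =>
      rw [sum_Ioc_succ_top (by omega)]
      have hn0 : (2 : ℝ) ≤ n := by exact_mod_cast hn
      have hl : 0 < Real.log n := Real.log_pos (by linarith)
      have hl' : 0 < Real.log (n + 1) := Real.log_pos (by linarith)
      have h1 := Real.log_le_sub_one_of_pos (div_pos hl hl')
      have h2 := Real.log_le_sub_one_of_pos (x := (n : ℝ) / (n + 1)) (by positivity)
      rw [Real.log_div (by positivity) (by positivity)] at h1 h2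
      have h3 : 1 / ((n + 1) * Real.log (n + 1)) ≤ 1 - Real.log n / Real.log (n + 1) := by
        rw [one_sub_div hl'.ne', ← div_div]
        gcongr
        rw [← neg_le_neg_iff, neg_sub]
        refine h2.trans (le_of_eq ?_)
        field_simp
        ring
      push_cast
      linarith
  refine ⟨|Real.log (Real.log 2)| + 1 / (2 * Real.log 2), fun x hx ↦ ?_⟩
  have hN : 3 ≤ ⌊x⌋₊ := Nat.le_floor (by exact_mod_cast hx)
  have hN' : (3 : ℝ) ≤ ⌊x⌋₊ := by exact_mod_cast hN
  have h1 := lower _ (by omega : 1 ≤ ⌊x⌋₊)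
  have h2 := upper _ (by omega : 2 ≤ ⌊x⌋₊)
  have h3 : Real.log (Real.log x) ≤ Real.log (Real.log (⌊x⌋₊ + 1)) :=
    Real.log_le_log (Real.log_pos (by linarith))
      (Real.log_le_log (by linarith) (Nat.lt_floor_add_one x).le)
  have h4 : Real.log (Real.log ⌊x⌋₊) ≤ Real.log (Real.log x) :=
    Real.log_le_log (Real.log_pos (by linarith))
      (Real.log_le_log (by linarith) (Nat.floor_le (by linarith)))
  have h5 : 0 < 1 / (2 * Real.log 2) := by positivity
  rw [abs_le]
  constructor <;> linarith [neg_abs_le (Real.log (Real.log 2)), le_abs_self (Real.log (Real.log 2))]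

/-- Passing from a weighted sum over `Λ n / n` to the corresponding sum over `1 / p`. -/
theorem norm_sum_prime_div_sub_log_log_le {c : ℕ → ℂ} {r : ℝ} (hc : ∀ n, ‖c n‖ ≤ 1)
    (h : ∃ B : ℝ, ∀ N : ℕ, ‖∑ n ∈ Ioc 0 N, (c n * Λ n / n - r / n)‖ ≤ B) :
    ∃ C : ℝ, ∀ x : ℝ, 3 ≤ x →
      ‖∑ p ∈ Ioc 0 ⌊x⌋₊ with p.Prime, c p / p - r * Real.log (Real.log x)‖ ≤ C := by
  obtain ⟨B, hB⟩ := h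
  obtain ⟨D, hD⟩ := abs_sum_inv_mul_log_sub_log_log_le
  have hsum := vonMangoldt.summable_residueClass_non_primes_div (0 : ZMod 1)
  have hres (n : ℕ) : vonMangoldt.residueClass (0 : ZMod 1) n = Λ n := by
    simp [vonMangoldt.residueClass, Subsingleton.elim _ (0 : ZMod 1)]
  simp only [hres] at hsum
  set T := ∑' n : ℕ, (if n.Prime then 0 else Λ n) / n
  let a (n : ℕ) : ℂ := (if n.Prime then c n * Λ n else 0) / n - r / n
  have ha (N : ℕ) : ‖∑ n ∈ Ioc 0 N, a n‖ ≤ B + T := by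
    have heq : ∑ n ∈ Ioc 0 N, a n = ∑ n ∈ Ioc 0 N, (c n * Λ n / n - r / n) -
        ∑ n ∈ Ioc 0 N, c n * ((if n.Prime then 0 else Λ n) / n : ℝ) := by
      rw [← sum_sub_distrib]
      refine sum_congr rfl fun n _ ↦ ?_
      by_cases hn : n.Prime
      · simp [a, hn]
      · simp [a, hn, mul_div_assoc]
    have hnn (n : ℕ) : 0 ≤ (if n.Prime then 0 else Λ n) / n := by
      have := vonMangoldt_nonneg (n := n)
      split_ifs <;> positivity
    rw [heq]
    refine (norm_sub_le _ _).trans (add_le_add (hB N) ?_)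
    refine (norm_sum_le_of_le _ fun n _ ↦ ?_).trans (hsum.sum_le_tsum (Ioc 0 N) fun n _ ↦ hnn n)
    rw [norm_mul, Complex.norm_real, Real.norm_of_nonneg (hnn n)]
    exact mul_le_of_le_one_left (hnn n) (hc n)
  have ha' (k : ℕ) : ‖∑ n ∈ Ioc 1 k, a n‖ ≤ (B + T) + (B + T) := by
    rcases Nat.eq_zero_or_pos k with rfl | hk
    · simpa using (norm_nonneg _).trans (ha 0)
    · rw [← sub_eq_of_eq_add' (sum_Ioc_consecutive a (Nat.zero_le 1) hk).symm]
      exact (norm_sub_le _ _).trans (add_le_add (ha k) (ha 1))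
  refine ⟨((B + T) + (B + T)) * (Real.log 2)⁻¹ + |r| * D, fun x hx ↦ ?_⟩
  have hN : 3 ≤ ⌊x⌋₊ := Nat.le_floor (by exact_mod_cast hx)
  have habel := norm_sum_smul_le_of_antitone (a := a) (f := fun n ↦ (Real.log n)⁻¹)
    (by omega : 1 ≤ ⌊x⌋₊) (fun i hi ↦ ?_) (fun i _ ↦ by positivity) ha'
  · have heq : ∑ p ∈ Ioc 0 ⌊x⌋₊ with p.Prime, c p / p - r * Real.log (Real.log x) =
        ∑ n ∈ Ioc 1 ⌊x⌋₊, (Real.log n)⁻¹ • a n +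
        r * ((∑ n ∈ Ioc 1 ⌊x⌋₊, 1 / (n * Real.log n) - Real.log (Real.log x) : ℝ) : ℂ) := by
      rw [Complex.ofReal_sub, Complex.ofReal_sum, mul_sub, mul_sum, ← add_sub_assoc,
        ← sum_add_distrib, sum_filter, ← sum_Ioc_consecutive _ (Nat.zero_le 1) (by omega)]
      congr 1
      rw [show ∑ n ∈ Ioc 0 1, (if n.Prime then c n / n else 0) = 0 by
        simp [Nat.not_prime_one], zero_add]
      refine sum_congr rfl fun n hn ↦ ?_
      have hn1 : 1 < n := (mem_Ioc.1 hn).1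
      have hl : (Real.log n : ℂ) ≠ 0 := by
        exact_mod_cast (Real.log_pos (by exact_mod_cast hn1)).ne'
      have hn0 : (n : ℂ) ≠ 0 := by exact_mod_cast (by omega : n ≠ 0)
      simp only [a, Complex.real_smul, Complex.ofReal_inv, Complex.ofReal_div, Complex.ofReal_mul,
        Complex.ofReal_one, Complex.ofReal_natCast]
      split_ifs with hp
      · rw [vonMangoldt_apply_prime hp]
        field_simp
        ring
      · field_simp
        ring
    rw [heq]
    refine (norm_add_le _ _).trans (add_le_add (by simpa [one_add_one_eq_two] using habel) ?_)
    rw [norm_mul, Complex.norm_real, Complex.norm_real]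
    exact mul_le_mul_of_nonneg_left (hD x hx) (abs_nonneg r)
  · have h1 : (1 : ℝ) < i := by exact_mod_cast hi
    have := Real.log_pos h1
    push_cast
    gcongr
    linarith

section JacobiSymbol

open scoped NumberTheorySymbols

/-- The Jacobi symbol `J(D | ·)` on odd numbers is given by a Dirichlet character. -/
theorem exists_dirichletCharacter_eq_jacobiSym {D : ℤ} (hD : D ≠ 0) :
    ∃ χ : DirichletCharacter ℂ (4 * D.natAbs), ∀ n : ℕ, Odd n → χ n = J(D | n) := by
  have hq : 4 * D.natAbs ≠ 0 := by simpa using hD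
  have : NeZero (4 * D.natAbs) := ⟨hq⟩
  have odd_mod (n : ℕ) : Odd (n % (4 * D.natAbs)) ↔ Odd n := by
    rw [Nat.odd_iff, Nat.odd_iff,
      Nat.mod_mod_of_dvd _ (Dvd.intro _ (by ring : 2 * (2 * D.natAbs) = _))]
  let χ : DirichletCharacter ℂ (4 * D.natAbs) :=
    { toFun := fun a ↦ if Odd a.val then (J(D | a.val) : ℂ) else 0
      map_one' := by simp [ZMod.val_one'' (by omega : 4 * D.natAbs ≠ 1)]
      map_mul' := fun a b ↦ by
        simp only [ZMod.val_mul, odd_mod, Nat.odd_mul]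
        by_cases ha : Odd a.val <;> by_cases hb : Odd b.val <;> simp only [ha, hb, and_self,
          and_false, false_and, if_true, if_false, mul_zero, zero_mul]
        rw [← jacobiSym.mod_right D (ha.mul hb), jacobiSym.mul_right' D ha.pos.ne' hb.pos.ne',
          Int.cast_mul]
      map_nonunit' := fun a ha ↦ by
        by_cases h : Odd a.val
        · simp only [h, if_true, Int.cast_eq_zero]
          refine jacobiSym.eq_zero_iff.2 ⟨h.pos.ne', fun hcop ↦ ha ?_⟩
          rw [← ZMod.natCast_zmod_val a, ZMod.isUnit_iff_coprime]
          refine Nat.Coprime.mul_right ?_ (Nat.Coprime.symm hcop)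
          exact Nat.Coprime.pow_right 2 h.coprime_two_right
        · simp [h] }
  refine ⟨χ, fun n hn ↦ ?_⟩
  change (if Odd (n : ZMod (4 * D.natAbs)).val then _ else _) = _
  rw [ZMod.val_natCast, if_pos ((odd_mod n).2 hn), ← jacobiSym.mod_right D hn]

theorem exists_jacobiSym_prime_eq_neg_one_and_eq_one {ℓ : ℕ} (hℓ : ℓ.Prime) {t : ℤ}
    (ht : ¬ (ℓ : ℤ) ∣ t) : ∃ n : ℕ, Odd n ∧ J(ℓ | n) = -1 ∧ J(t | n) = 1 := by
  have ht0 : t.natAbs ≠ 0 := by rintro h; simp_all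
  have of_modEq {n : ℕ} (hn : n ≡ 1 [MOD 4 * t.natAbs]) : n % 4 = 1 ∧ J(t | n) = 1 := by
    have h4 : n % 4 = 1 := hn.of_mul_right _
    refine ⟨h4, ?_⟩
    rw [jacobiSym.mod_right t (Nat.odd_iff.2 (by omega)), hn, Nat.mod_eq_of_lt (by omega),
      jacobiSym.one_right]
  rcases hℓ.eq_two_or_odd' with rfl | hodd
  · have h8 : (1 + 4 * t.natAbs) % 8 = 5 := by
      have : ¬ 2 ∣ t.natAbs := fun h ↦ ht (Int.natCast_dvd.2 h)
      omega
    have hn : Odd (1 + 4 * t.natAbs) := Nat.odd_iff.2 (by omega)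
    refine ⟨1 + 4 * t.natAbs, hn, ?_, (of_modEq (by simp [Nat.ModEq])).2⟩
    rw [Nat.cast_ofNat, jacobiSym.at_two hn, ZMod.χ₈_nat_eq_if_mod_eight, h8, if_neg (by omega)]
    norm_num
  · have : Fact ℓ.Prime := ⟨hℓ⟩
    obtain ⟨u, hu⟩ := FiniteField.exists_nonsquare (F := ZMod ℓ) (by
      rw [ZMod.ringChar_zmod_n]
      rintro rfl
      exact absurd hodd (by decide))
    have hcop : Nat.Coprime (4 * t.natAbs) ℓ := by
      refine Nat.Coprime.mul_left (Nat.Coprime.pow_left 2 hodd.coprime_two_left) ?_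
      exact ((hℓ.coprime_iff_not_dvd).2 fun h ↦ ht (Int.natCast_dvd.2 h)).symm
    obtain ⟨n, hn1, hnu⟩ := Nat.chineseRemainder hcop 1 u.val
    obtain ⟨h4, hJ⟩ := of_modEq hn1
    refine ⟨n, Nat.odd_iff.2 (by omega), ?_, hJ⟩
    rw [jacobiSym.quadratic_reciprocity_one_mod_four' hodd h4, ← jacobiSym.legendreSym.to_jacobiSym,
      legendreSym.eq_neg_one_iff', (ZMod.natCast_eq_natCast_iff _ _ _).2 hnu,
      ZMod.natCast_zmod_val]
    exact hu

theorem exists_jacobiSym_eq_neg_one_of_not_isSquare {D : ℤ} (hD : ¬ IsSquare D) :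
    ∃ n : ℕ, Odd n ∧ J(D | n) = -1 := by
  have hD0 : D ≠ 0 := by rintro rfl; exact hD ⟨0, rfl⟩
  obtain ⟨a, b, hab, ha⟩ := Nat.sq_mul_squarefree D.natAbs
  have hb0 : b ≠ 0 := by
    rintro rfl
    exact hD0 (Int.natAbs_eq_zero.1 (by simp [← hab]))
  by_cases ha1 : a = 1
  · have hDb : D = -(b ^ 2 : ℤ) := by
      rw [ha1, mul_one] at hab
      rcases Int.natAbs_eq D with h | h
      · exact absurd ⟨(b : ℤ), by rw [h, ← hab]; push_cast; ring⟩ hD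
      · rw [h, ← hab]; push_cast; ring
    obtain ⟨m, hm⟩ := Nat.exists_eq_succ_of_ne_zero (pow_ne_zero 2 hb0)
    have hodd : Odd (4 * m + 3) := Nat.odd_iff.2 (by omega)
    refine ⟨4 * m + 3, hodd, ?_⟩
    have hmod : J(4 * D | 4 * m + 3) = J(-1 | 4 * m + 3) := by
      refine jacobiSym.mod_left' (Int.ModEq.symm ?_)
      refine (Int.modEq_iff_dvd).2 ⟨-1, ?_⟩
      have : (b : ℤ) ^ 2 = m + 1 := by exact_mod_cast hm
      rw [hDb, this]
      push_cast
      ring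
    rw [jacobiSym.mul_left, jacobiSym.at_four hodd, one_mul] at hmod
    rw [hmod, jacobiSym.at_neg_one hodd, ZMod.χ₄_nat_three_mod_four (by omega)]
  · obtain ⟨ℓ, hℓ, a', rfl⟩ := Nat.exists_prime_and_dvd ha1
    obtain ⟨j, b', hb', rfl⟩ := Nat.exists_eq_pow_mul_and_not_dvd hb0 ℓ hℓ.ne_one
    have ha' : ¬ ℓ ∣ a' := fun h ↦ hℓ.ne_one (Nat.isUnit_iff.1 (ha ℓ (mul_dvd_mul_left ℓ h)))
    set t : ℤ := D.sign * (b' ^ 2 * a' : ℕ)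
    have hDt : D = (ℓ : ℤ) ^ (2 * j + 1) * t := by
      conv_lhs => rw [← Int.sign_mul_natAbs D, ← hab]
      simp only [t]
      push_cast
      ring
    have ht : ¬ (ℓ : ℤ) ∣ t := by
      rw [Int.natCast_dvd, Int.natAbs_mul, Int.natAbs_sign_of_ne_zero hD0, one_mul,
        Int.natAbs_natCast, hℓ.dvd_mul, not_or]
      exact ⟨fun h ↦ hb' (hℓ.dvd_of_dvd_pow h), ha'⟩
    obtain ⟨n, hn, h1, h2⟩ := exists_jacobiSym_prime_eq_neg_one_and_eq_one hℓ ht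
    refine ⟨n, hn, ?_⟩
    rw [hDt, jacobiSym.mul_left, jacobiSym.pow_left, h1, h2, pow_succ, pow_mul]
    norm_num

theorem jacobiSym_sq_eq_one_of_prime_of_not_dvd {p : ℕ} (hp : p.Prime) {a : ℤ}
    (h : ¬ (p : ℤ) ∣ a) : J(a | p) ^ 2 = 1 :=
  jacobiSym.sq_one ((hp.coprime_iff_not_dvd.2 fun h' ↦ h (Int.natCast_dvd.2 h')).symm)

theorem abs_jacobiSym_le_one (a : ℤ) (n : ℕ) : |(J(a | n) : ℝ)| ≤ 1 := by
  rcases jacobiSym.trichotomy a n with h | h | h <;> simp [h]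

end JacobiSymbol

/-- the variance sum of the Legendre-symbol weight is (1/2) log log x + O(1). -/
theorem legendre_weight_variance (Δ Δ' : ℤ)
    (h1 : ¬ IsSquare Δ) (h2 : ¬ IsSquare Δ') (h3 : ¬ IsSquare (Δ * Δ'))
    (w : ℕ → ℝ)
    (hw : ∀ p : ℕ, p.Prime →
      w p = if Odd p ∧ ¬ ((p : ℤ) ∣ Δ)
        then ((jacobiSym Δ' p : ℝ) - (jacobiSym Δ p : ℝ)) / 2 else 0) :
    ∃ C : ℝ, ∀ x : ℝ, 3 ≤ x →
      |(∑ p ∈ Nat.primesBelow (⌊x⌋₊ + 1), w p ^ 2 / p) -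
        (1 / 2) * Real.log (Real.log x)| ≤ C := by
  set D := Δ * Δ'
  have hD0 : D ≠ 0 := by intro h; exact h3 (h ▸ ⟨0, rfl⟩)
  have : NeZero (4 * D.natAbs) := ⟨by simpa using hD0⟩
  obtain ⟨χ, hχ⟩ := exists_dirichletCharacter_eq_jacobiSym hD0
  have hχ1 : χ ≠ 1 := by
    rintro rfl
    obtain ⟨n, hn, hJ⟩ := exists_jacobiSym_eq_neg_one_of_not_isSquare h3
    have h := hχ n hn
    rw [hJ] at h
    by_cases hu : IsUnit (n : ZMod (4 * D.natAbs))
    · rw [MulChar.one_apply hu] at h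
      norm_num at h
    · rw [MulChar.map_nonunit _ hu] at h
      norm_num at h
  obtain ⟨A, hA⟩ := norm_sum_prime_div_sub_log_log_le (c := fun n ↦ χ n) (r := 0)
    (fun n ↦ χ.norm_le_one _) (by simpa using χ.norm_sum_mul_vonMangoldt_div_le hχ1)
  obtain ⟨B, hB⟩ := norm_sum_prime_div_sub_log_log_le (c := fun _ ↦ 1) (r := 1) (by simp) (by
    obtain ⟨B, hB⟩ := abs_sum_vonMangoldt_div_sub_le
    refine ⟨B, fun N ↦ (le_of_eq ?_).trans (hB N)⟩
    rw [← Real.norm_eq_abs, ← Complex.norm_real]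
    push_cast
    simp only [one_mul])
  have hw1 (p : ℕ) (hp : p.Prime) : w p ^ 2 ≤ 1 := by
    have h := abs_le.1 (abs_jacobiSym_le_one Δ p)
    have h' := abs_le.1 (abs_jacobiSym_le_one Δ' p)
    rw [hw p hp, sq_le_one_iff_abs_le_one, abs_le]
    split_ifs <;> constructor <;> linarith
  have herr (p : ℕ) (hp : p.Prime) (hpD : 2 * D.natAbs < p) :
      (w p : ℂ) ^ 2 - 1 / 2 + χ p / 2 = 0 := by
    have hDpos : 0 < D.natAbs := Int.natAbs_pos.2 hD0
    have hodd : Odd p := hp.odd_of_ne_two (by omega)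
    have hdvd : ¬ (p : ℤ) ∣ D := fun h ↦ by
      have := Nat.le_of_dvd hDpos (Int.natCast_dvd.1 h)
      omega
    have hΔ : ¬ (p : ℤ) ∣ Δ := fun h ↦ hdvd (h.mul_right _)
    have hΔ' : ¬ (p : ℤ) ∣ Δ' := fun h ↦ hdvd (h.mul_left _)
    have e : (jacobiSym Δ p : ℂ) ^ 2 = 1 := by
      exact_mod_cast jacobiSym_sq_eq_one_of_prime_of_not_dvd hp hΔ
    have e' : (jacobiSym Δ' p : ℂ) ^ 2 = 1 := by
      exact_mod_cast jacobiSym_sq_eq_one_of_prime_of_not_dvd hp hΔ'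
    rw [hχ p hodd, hw p hp, if_pos ⟨hodd, hΔ⟩, jacobiSym.mul_left]
    push_cast
    linear_combination (e + e') / 4
  have hbound (p : ℕ) (hp : p.Prime) : ‖((w p : ℂ) ^ 2 - 1 / 2 + χ p / 2) / p‖ ≤ 2 := by
    have hnum : ‖(w p : ℂ) ^ 2 - 1 / 2 + χ p / 2‖ ≤ 2 := by
      refine (norm_add_le _ _).trans ((add_le_add_left (norm_sub_le _ _) _).trans ?_)
      have := χ.norm_le_one p
      simp only [norm_pow, Complex.norm_real, Real.norm_eq_abs, sq_abs, norm_div, norm_one,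
        Complex.norm_ofNat]
      linarith [hw1 p hp]
    rw [norm_div, Complex.norm_natCast]
    exact (div_le_self (norm_nonneg _) (by exact_mod_cast hp.one_le)).trans hnum
  refine ⟨B / 2 + A / 2 + 2 * (2 * D.natAbs), fun x hx ↦ ?_⟩
  have hset : Nat.primesBelow (⌊x⌋₊ + 1) = {p ∈ Ioc 0 ⌊x⌋₊ | p.Prime} := by
    ext p
    simp only [Nat.mem_primesBelow, mem_filter, mem_Ioc]
    exact ⟨fun h ↦ ⟨⟨h.2.pos, by omega⟩, h.2⟩, fun h ↦ ⟨by omega, h.2⟩⟩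
  have hE : ‖∑ p ∈ Ioc 0 ⌊x⌋₊ with p.Prime, ((w p : ℂ) ^ 2 - 1 / 2 + χ p / 2) / p‖ ≤
      2 * (2 * D.natAbs) := by
    rw [← sum_filter_add_sum_filter_not _ (fun p ↦ p ≤ 2 * D.natAbs),
      sum_eq_zero (s := filter (fun p ↦ ¬ p ≤ 2 * D.natAbs) _) fun p hp ↦ by
        simp only [mem_filter, not_le] at hp
        rw [herr p hp.1.2 hp.2, zero_div], add_zero]
    refine (norm_sum_le_of_le _ fun p hp ↦ hbound p (by simp_all)).trans ?_
    rw [sum_const, nsmul_eq_mul, mul_comm]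
    refine mul_le_mul_of_nonneg_left ?_ zero_le_two
    have hsub := card_le_card (show filter (fun p ↦ p ≤ 2 * D.natAbs)
      {p ∈ Ioc 0 ⌊x⌋₊ | p.Prime} ⊆ Ioc 0 (2 * D.natAbs) from fun p hp ↦ by
        simp only [mem_filter, mem_Ioc] at hp ⊢
        exact ⟨hp.1.1.1, hp.2⟩)
    rw [Nat.card_Ioc, Nat.sub_zero] at hsub
    exact_mod_cast hsub
  have hmain : ((∑ p ∈ Nat.primesBelow (⌊x⌋₊ + 1), w p ^ 2 / p -
      1 / 2 * Real.log (Real.log x) : ℝ) : ℂ) =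
      (∑ p ∈ Ioc 0 ⌊x⌋₊ with p.Prime, 1 / (p : ℂ) - (1 : ℝ) * Real.log (Real.log x)) / 2 -
      (∑ p ∈ Ioc 0 ⌊x⌋₊ with p.Prime, χ p / p - (0 : ℝ) * Real.log (Real.log x)) / 2 +
      ∑ p ∈ Ioc 0 ⌊x⌋₊ with p.Prime, ((w p : ℂ) ^ 2 - 1 / 2 + χ p / 2) / p := by
    have hsplit : ∑ p ∈ Ioc 0 ⌊x⌋₊ with p.Prime, (w p : ℂ) ^ 2 / p =
        (∑ p ∈ Ioc 0 ⌊x⌋₊ with p.Prime, 1 / (p : ℂ)) / 2 -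
        (∑ p ∈ Ioc 0 ⌊x⌋₊ with p.Prime, χ p / p) / 2 +
        ∑ p ∈ Ioc 0 ⌊x⌋₊ with p.Prime, ((w p : ℂ) ^ 2 - 1 / 2 + χ p / 2) / p := by
      rw [sum_div, sum_div, ← sum_sub_distrib, ← sum_add_distrib]
      exact sum_congr rfl fun p _ ↦ by ring
    rw [hset]
    push_cast
    rw [hsplit]
    ring
  rw [← Real.norm_eq_abs, ← Complex.norm_real, hmain]
  refine (norm_add_le _ _).trans (add_le_add ((norm_sub_le _ _).trans ?_) hE)
  rw [norm_div, norm_div, Complex.norm_ofNat]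
  have := hA x hx
  have := hB x hx
  gcongr
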